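/- arXiv:2105.09217 — 2 statements merged into one kernel-verified Lean document; each statement's English description precedes it below -/
import Mathlib

section
/- Let S be a finite set of points in the Euclidean plane with |S| ≥ 3, and let ρ > 0 satisfy cost₂(S) ≥ 2√3·ρ. Then for every point x of ℝ², at most two points of S lie at Euclidean distance strictly less than ρ from x; that is, any open disk of radius ρ properly contains at most two points of S. -/
open scoped Classical

/-- `cost₂(p, S)`: the minimum over pairs of distinct points `q, q' ∈ S \ {p}` of
`d(p,q) + d(p,q')`. -/
noncomputable def cost2At (p : EuclideanSpace ℝ (Fin 2))
    (S : Finset (EuclideanSpace ℝ (Fin 2))) : ℝ :=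
  sInf {x : ℝ | ∃ q ∈ S.erase p, ∃ q' ∈ S.erase p, q ≠ q' ∧ x = dist p q + dist p q'}

/-- `cost₂(S) = min_{p ∈ S} cost₂(p, S)`. -/
noncomputable def cost2 (S : Finset (EuclideanSpace ℝ (Fin 2))) : ℝ :=
  sInf {x : ℝ | ∃ p ∈ S, x = cost2At p S}

lemma cost2_le_aux (S : Finset (EuclideanSpace ℝ (Fin 2))) (p q r : EuclideanSpace ℝ (Fin 2))
    (hp : p ∈ S) (hq : q ∈ S) (hr : r ∈ S) (hpq : p ≠ q) (hpr : p ≠ r) (hqr : q ≠ r) :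
    cost2 S ≤ dist p q + dist p r := by
  have h1 : cost2 S ≤ cost2At p S := by
    apply csInf_le
    · refine ⟨0, ?_⟩
      rintro y ⟨p', _, rfl⟩
      apply Real.sInf_nonneg
      rintro z ⟨q, _, q', _, _, rfl⟩
      positivity
    · exact ⟨p, hp, rfl⟩
  refine h1.trans ?_
  apply csInf_le
  · refine ⟨0, ?_⟩
    rintro z ⟨q, _, q', _, _, rfl⟩
    positivity
  · exact ⟨q, Finset.mem_erase.2 ⟨hpq.symm, hq⟩, r, Finset.mem_erase.2 ⟨hpr.symm, hr⟩, hqr, rfl⟩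

lemma dist_sq_aux (x a b c : EuclideanSpace ℝ (Fin 2)) :
    dist a b ^ 2 + dist a c ^ 2 + dist b c ^ 2
      ≤ 3 * (dist x a ^ 2 + dist x b ^ 2 + dist x c ^ 2) := by
  simp only [EuclideanSpace.dist_eq, Fin.sum_univ_two, Real.dist_eq, sq_abs]
  repeat rw [Real.sq_sqrt (by positivity)]
  nlinarith [sq_nonneg (3 * x 0 - a 0 - b 0 - c 0), sq_nonneg (3 * x 1 - a 1 - b 1 - c 1)]

/-- if `cost₂(S) ≥ 2√3·ρ` then any open disk of radius `ρ` properly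
contains at most two points of `S`. -/
theorem open_disk_properly_contains_at_most_two
    (S : Finset (EuclideanSpace ℝ (Fin 2))) (hS : 3 ≤ S.card)
    (ρ : ℝ) (hρ : 0 < ρ) (hcost : 2 * Real.sqrt 3 * ρ ≤ cost2 S)
    (x : EuclideanSpace ℝ (Fin 2)) :
    (S.filter fun p => dist x p < ρ).card ≤ 2 := by
  by_contra hcon
  push Not at hcon
  obtain ⟨a, b, c, ha, hb, hc, hab, hac, hbc⟩ := Finset.two_lt_card_iff.1 hcon
  rw [Finset.mem_filter] at ha hb hc
  have h1 := hcost.trans (cost2_le_aux S a b c ha.1 hb.1 hc.1 hab hac hbc)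
  have h2 := hcost.trans (cost2_le_aux S b a c hb.1 ha.1 hc.1 hab.symm hbc hac)
  have h3 := hcost.trans (cost2_le_aux S c a b hc.1 ha.1 hb.1 hac.symm hbc.symm hab)
  rw [dist_comm b a] at h2
  rw [dist_comm c a, dist_comm c b] at h3
  have h4 := dist_sq_aux x a b c
  have ea : dist x a ^ 2 < ρ ^ 2 := by gcongr; exact ha.2
  have eb : dist x b ^ 2 < ρ ^ 2 := by gcongr; exact hb.2
  have ec : dist x c ^ 2 < ρ ^ 2 := by gcongr; exact hc.2
  have hs : Real.sqrt 3 ^ 2 = 3 := Real.sq_sqrt (by norm_num)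
  have h5 : 3 * (Real.sqrt 3 * ρ) ≤ dist a b + dist a c + dist b c := by linarith
  have h6 : (3 * (Real.sqrt 3 * ρ)) ^ 2 ≤ (dist a b + dist a c + dist b c) ^ 2 := by gcongr
  have h7 : (3 * (Real.sqrt 3 * ρ)) ^ 2 = 27 * ρ ^ 2 := by
    rw [mul_pow, mul_pow, hs]; ring
  nlinarith [sq_nonneg (dist a b - dist a c), sq_nonneg (dist a b - dist b c),
    sq_nonneg (dist a c - dist b c)]
end

section
/- Let S be a finite set of points in the Euclidean plane with |S| ≥ 3, let ρ > 0 satisfy cost₂(S) ≥ ρ, and let q be a point of ℝ² with q ∉ S such that at most one point of S lies at Euclidean distance strictly less than ρ from q. Then cost₂(S ∪ {q}) ≥ ρ. -/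
open scoped Classical

theorem le_cost2At_aux (p : EuclideanSpace ℝ (Fin 2)) (S : Finset (EuclideanSpace ℝ (Fin 2)))
    (hS : 3 ≤ S.card) (ρ : ℝ)
    (h : ∀ a ∈ S, ∀ b ∈ S, a ≠ p → b ≠ p → a ≠ b → ρ ≤ dist p a + dist p b) :
    ρ ≤ cost2At p S := by
  unfold cost2At
  apply le_csInf
  · have h1 : 1 < (S.erase p).card := by
      have := Finset.pred_card_le_card_erase (s := S) (a := p)
      omega
    obtain ⟨a, ha, b, hb, hab⟩ := Finset.one_lt_card.mp h1
    exact ⟨_, a, ha, b, hb, hab, rfl⟩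
  · rintro x ⟨a, ha, b, hb, hab, rfl⟩
    rw [Finset.mem_erase] at ha hb
    exact h a ha.2 b hb.2 ha.1 hb.1 hab

theorem cost2_le_aux_s9 (S : Finset (EuclideanSpace ℝ (Fin 2))) (p a b : EuclideanSpace ℝ (Fin 2))
    (hp : p ∈ S) (ha : a ∈ S) (hb : b ∈ S) (hap : a ≠ p) (hbp : b ≠ p) (hab : a ≠ b) :
    cost2 S ≤ dist p a + dist p b := by
  have h1 : cost2 S ≤ cost2At p S := by
    unfold cost2
    refine csInf_le ?_ ⟨p, hp, rfl⟩
    refine ⟨0, ?_⟩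
    rintro x ⟨r, hr, rfl⟩
    apply Real.sInf_nonneg
    rintro x ⟨c, hc, d, hd, hcd, rfl⟩
    positivity
  refine h1.trans ?_
  unfold cost2At
  apply csInf_le
  · refine ⟨0, ?_⟩
    rintro x ⟨c, hc, d, hd, hcd, rfl⟩
    positivity
  · exact ⟨a, Finset.mem_erase.mpr ⟨hap, ha⟩, b, Finset.mem_erase.mpr ⟨hbp, hb⟩, hab, rfl⟩

/-- if `cost₂(S) ≥ ρ` and `q ∉ S` has at most one point of `S` at
distance strictly less than `ρ`, then `cost₂(S ∪ {q}) ≥ ρ`. -/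
theorem cost2_insert_ge
    (S : Finset (EuclideanSpace ℝ (Fin 2))) (hS : 3 ≤ S.card)
    (ρ : ℝ) (hρ : 0 < ρ) (hcost : ρ ≤ cost2 S)
    (q : EuclideanSpace ℝ (Fin 2)) (hq : q ∉ S)
    (hnear : (S.filter fun p => dist q p < ρ).card ≤ 1) :
    ρ ≤ cost2 (insert q S) := by
  have near : ∀ a ∈ S, ∀ b ∈ S, a ≠ b → ρ ≤ dist q a ∨ ρ ≤ dist q b := by
    intro a ha b hb hab
    by_contra! hc
    exact hab (Finset.card_le_one.mp hnear a (Finset.mem_filter.mpr ⟨ha, hc.1⟩) b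
      (Finset.mem_filter.mpr ⟨hb, hc.2⟩))
  have mixed : ∀ p ∈ S, ∀ b ∈ S, b ≠ p → ρ ≤ dist p q + dist p b := by
    intro p hp b hb hbp
    have h1 := dist_triangle q p b
    have h2 := dist_comm q p
    have h3 : 0 ≤ dist p b := dist_nonneg
    rcases near p hp b hb hbp.symm with h | h <;> linarith
  unfold cost2
  apply le_csInf
  · exact ⟨_, q, Finset.mem_insert_self q S, rfl⟩
  rintro x ⟨p, hp, rfl⟩
  apply le_cost2At_aux
  · exact hS.trans (Finset.card_le_card (Finset.subset_insert q S))
  intro a ha b hb hap hbp hab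
  rw [Finset.mem_insert] at hp ha hb
  rcases hp with rfl | hp
  · have ha' := ha.resolve_left hap
    have hb' := hb.resolve_left hbp
    have h1 : 0 ≤ dist p a := dist_nonneg
    have h2 : 0 ≤ dist p b := dist_nonneg
    rcases near a ha' b hb' hab with h | h <;> linarith
  · rcases ha with rfl | ha
    · exact mixed p hp b (hb.resolve_left hab.symm) hbp
    · rcases hb with rfl | hb
      · have := mixed p hp a ha hap
        linarith
      · exact hcost.trans (cost2_le_aux_s9 S p a b hp ha hb hap hbp hab)
end
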